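/- Let X be a subprojective real Banach space, let λ be an ordinal, let K be a compact Hausdorff space that is sequentially compact, and let φ : K → [0,λ] be a continuous surjection, where [0,λ] is the set of ordinals at most λ with the order topology. Then the subspace Z₀ = { g ∘ φ : g ∈ C([0,λ], X), g(λ) = 0 } is a closed subspace of C(K,X) and is subprojective with respect to C(K,X). -/

import Mathlib

/-- A real normed space `X` is *subprojective* if every closed infinite-dimensional
subspace of `X` contains an infinite-dimensional closed subspace that is
complemented in `X`. -/
def Subprojective (X : Type*) [NormedAddCommGroup X] [NormedSpace ℝ X] : Prop :=
  ∀ M : Submodule ℝ X, IsClosed (M : Set X) → ¬ FiniteDimensional ℝ M →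
    ∃ N : Submodule ℝ X, N ≤ M ∧ IsClosed (N : Set X) ∧ ¬ FiniteDimensional ℝ N ∧
      N.ClosedComplemented

/-- A subspace `Z` of `X` is *subprojective with respect to `X`* if every closed
infinite-dimensional subspace of `Z` contains an infinite-dimensional closed
subspace that is complemented in `X`. -/
def SubprojectiveWrt {X : Type*} [NormedAddCommGroup X] [NormedSpace ℝ X]
    (Z : Submodule ℝ X) : Prop :=
  ∀ M : Submodule ℝ X, M ≤ Z → IsClosed (M : Set X) → ¬ FiniteDimensional ℝ M →
    ∃ N : Submodule ℝ X, N ≤ M ∧ IsClosed (N : Set X) ∧ ¬ FiniteDimensional ℝ N ∧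
      N.ClosedComplemented

/-- The subspace `{ g ∘ φ : g ∈ C([0,l], X), g(l) = 0 }` of `C(K, X)`. -/
def compSubmodule0 {K : Type*} [TopologicalSpace K] {l : Ordinal}
    (X : Type*) [NormedAddCommGroup X] [NormedSpace ℝ X] (φ : C(K, Set.Iic l)) :
    Submodule ℝ C(K, X) where
  carrier := { f | ∃ g : C(Set.Iic l, X), f = g.comp φ ∧ g ⟨l, Set.mem_Iic.mpr le_rfl⟩ = 0 }
  add_mem' := by
    rintro f₁ f₂ ⟨g₁, rfl, h₁⟩ ⟨g₂, rfl, h₂⟩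
    exact ⟨g₁ + g₂, by ext k; simp, by simp [h₁, h₂]⟩
  zero_mem' := ⟨0, by ext k; simp, rfl⟩
  smul_mem' := by
    rintro c f ⟨g, rfl, h⟩
    exact ⟨c • g, by ext k; simp, by simp [h]⟩


open Filter Topology

/-- There is a continuous idempotent with infinite-dimensional range inside `M`. -/
def SpGood {E : Type*} [NormedAddCommGroup E] [NormedSpace ℝ E] (M : Submodule ℝ E) : Prop :=
  ∃ P : E →L[ℝ] E, (∀ x, P (P x) = P x) ∧ (∀ x, P x ∈ M) ∧
    ¬ FiniteDimensional ℝ (LinearMap.range P.toLinearMap)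

lemma SpGood.mono {E : Type*} [NormedAddCommGroup E] [NormedSpace ℝ E] {M M' : Submodule ℝ E}
    (h : M ≤ M') (hM : SpGood M) : SpGood M' := by
  obtain ⟨P, h1, h2, h3⟩ := hM
  exact ⟨P, h1, fun x => h (h2 x), h3⟩

lemma SpGood.exists_compl {E : Type*} [NormedAddCommGroup E] [NormedSpace ℝ E]
    {M : Submodule ℝ E} (hM : SpGood M) :
    ∃ N : Submodule ℝ E, N ≤ M ∧ IsClosed (N : Set E) ∧ ¬ FiniteDimensional ℝ N ∧
      N.ClosedComplemented := by
  obtain ⟨P, h1, h2, h3⟩ := hM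
  refine ⟨LinearMap.range P.toLinearMap, ?_, ?_, h3, ?_⟩
  · rintro _ ⟨x, rfl⟩
    exact h2 x
  · have : ((LinearMap.range P.toLinearMap : Submodule ℝ E) : Set E) = {x | P x = x} := by
      ext x
      constructor
      · rintro ⟨y, rfl⟩
        exact h1 y
      · intro hx
        exact ⟨x, hx⟩
    rw [this]
    exact isClosed_eq P.continuous continuous_id
  · refine ⟨P.codRestrict _ (fun x => ⟨x, rfl⟩), ?_⟩
    rintro ⟨_, ⟨y, rfl⟩⟩
    apply Subtype.ext
    exact h1 y

lemma SpGood.of_compl {E : Type*} [NormedAddCommGroup E] [NormedSpace ℝ E]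
    {M N : Submodule ℝ E} (hNM : N ≤ M) (hN : ¬ FiniteDimensional ℝ N)
    (hc : N.ClosedComplemented) : SpGood M := by
  obtain ⟨p, hp⟩ := hc
  refine ⟨N.subtypeL.comp p, fun x => ?_, fun x => hNM (p x).2, ?_⟩
  · simp [hp]
  · have : LinearMap.range (N.subtypeL.comp p).toLinearMap = N := by
      ext x
      constructor
      · rintro ⟨y, rfl⟩
        exact (p y).2
      · intro hx
        exact ⟨x, by simpa using congrArg Subtype.val (hp ⟨x, hx⟩)⟩
    rw [this]
    exact hN

lemma sp_not_fd_of_linInd {E : Type*} [AddCommGroup E] [Module ℝ E] (N : Submodule ℝ E)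
    (x : ℕ → E) (hx : ∀ n, x n ∈ N) (li : LinearIndependent ℝ x) : ¬ FiniteDimensional ℝ N := by
  intro h
  have li' : LinearIndependent ℝ (fun n => (⟨x n, hx n⟩ : N)) :=
    LinearIndependent.of_comp N.subtype li
  have := li'.lt_aleph0_of_finiteDimensional
  simp at this

section transfer
variable {E F : Type*} [NormedAddCommGroup E] [NormedSpace ℝ E] [NormedAddCommGroup F]
  [NormedSpace ℝ F]

lemma sp_map_closed [CompleteSpace E] (T : E →L[ℝ] F) (M : Submodule ℝ E)
    (hM : IsClosed (M : Set E)) (C : ℝ) (hC : ∀ x ∈ M, ‖x‖ ≤ C * ‖T x‖) :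
    IsClosed ((M.map T.toLinearMap : Submodule ℝ F) : Set F) := by
  have : CompleteSpace M := hM.completeSpace_coe
  have ha : AntilipschitzWith (Real.toNNReal C) (T.comp M.subtypeL) := by
    apply AddMonoidHomClass.antilipschitz_of_bound
    intro x
    refine (hC x x.2).trans ?_
    simp only [ContinuousLinearMap.comp_apply, Submodule.subtypeL_apply]
    gcongr
    exact Real.le_coe_toNNReal C
  have := ha.isClosed_range (T.comp M.subtypeL).uniformContinuous
  convert this
  ext y
  simp

lemma sp_injOn (T : E →L[ℝ] F) (M : Submodule ℝ E)
    (C : ℝ) (hC : ∀ x ∈ M, ‖x‖ ≤ C * ‖T x‖) (x y : E) (hx : x ∈ M) (hy : y ∈ M)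
    (h : T x = T y) : x = y := by
  have := hC (x - y) (M.sub_mem hx hy)
  simp [h] at this
  exact sub_eq_zero.1 this

lemma sp_map_not_fd (T : E →L[ℝ] F) (M : Submodule ℝ E)
    (hM : ¬ FiniteDimensional ℝ M) (C : ℝ) (hC : ∀ x ∈ M, ‖x‖ ≤ C * ‖T x‖) :
    ¬ FiniteDimensional ℝ (M.map T.toLinearMap) := by
  intro h
  apply hM
  have e : M ≃ₗ[ℝ] (M.map T.toLinearMap) := by
    refine LinearEquiv.ofBijective (T.toLinearMap.submoduleMap M) ⟨?_, T.toLinearMap.submoduleMap_surjective M⟩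
    intro x y hxy
    apply Subtype.ext
    exact sp_injOn T M C hC x y x.2 y.2 (congrArg Subtype.val hxy)
  exact e.symm.finiteDimensional

lemma sp_map_good (T : E →L[ℝ] F) (M : Submodule ℝ E)
    (C : ℝ) (hC : ∀ x ∈ M, ‖x‖ ≤ C * ‖T x‖) (hG : SpGood (M.map T.toLinearMap)) :
    SpGood M := by
  obtain ⟨P, h1, h2, h3⟩ := hG
  choose S hSM hS using fun x => h2 x
  have hSM' : ∀ x, S x ∈ M := hSM
  have hS' : ∀ x, T (S x) = P x := hS
  have inj := sp_injOn T M C hC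
  let L : F →ₗ[ℝ] E :=
    { toFun := S
      map_add' := fun x y => inj _ _ (hSM' _) (M.add_mem (hSM' _) (hSM' _)) (by simp [hS'])
      map_smul' := fun c x => inj _ _ (hSM' _) (M.smul_mem _ (hSM' _)) (by simp [hS']) }
  let Lc : F →L[ℝ] E := L.mkContinuous (|C| * ‖P‖) (fun x => by
    change ‖S x‖ ≤ _
    refine (hC _ (hSM' x)).trans ?_
    rw [hS', mul_assoc]
    exact mul_le_mul (le_abs_self C) (P.le_opNorm x) (norm_nonneg _) (abs_nonneg _))
  have hL : ∀ x, Lc x = S x := fun x => rfl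
  refine ⟨Lc.comp T, fun x => ?_, fun x => hSM' _, ?_⟩
  · simp only [ContinuousLinearMap.comp_apply, hL]
    exact inj _ _ (hSM' _) (hSM' _) (by simp [hS', h1])
  · intro hfd
    apply h3
    have : LinearMap.range P.toLinearMap ≤
        (LinearMap.range (Lc.comp T).toLinearMap).map T.toLinearMap := by
      rintro _ ⟨y, rfl⟩
      refine ⟨Lc (T (S y)), ⟨S y, rfl⟩, ?_⟩
      simp [hL, hS', h1]
    exact Submodule.finiteDimensional_of_le this

/-- if not bounded below there are unit vectors with small image -/
lemma sp_small_vec (T : E →L[ℝ] F) (M : Submodule ℝ E)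
    (h : ¬ ∃ C : ℝ, ∀ x ∈ M, ‖x‖ ≤ C * ‖T x‖) (ε : ℝ) (hε : 0 < ε) :
    ∃ x ∈ M, ‖x‖ = 1 ∧ ‖T x‖ ≤ ε := by
  push Not at h
  obtain ⟨x, hx, hlt⟩ := h ε⁻¹
  have hpos : 0 < ‖x‖ := lt_of_le_of_lt (by positivity) hlt
  refine ⟨‖x‖⁻¹ • x, M.smul_mem _ hx, ?_, ?_⟩
  · rw [norm_smul, norm_inv, norm_norm, inv_mul_cancel₀ hpos.ne']
  · rw [map_smul, norm_smul, norm_inv, norm_norm, inv_mul_le_iff₀ hpos]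
    rw [inv_mul_lt_iff₀ hε] at hlt
    linarith

lemma sp_inf_ker_not_fd (M : Submodule ℝ E) (hM : ¬ FiniteDimensional ℝ M)
    (s : Finset (E →L[ℝ] ℝ)) :
    ∃ M' ≤ M, (∀ x ∈ M', ∀ f ∈ s, f x = 0) ∧ ¬ FiniteDimensional ℝ M' ∧
      (IsClosed (M : Set E) → IsClosed (M' : Set E)) := by
  let L : E →L[ℝ] (s → ℝ) := ContinuousLinearMap.pi (fun f => f.1)
  refine ⟨M ⊓ LinearMap.ker L.toLinearMap, inf_le_left, ?_, ?_, ?_⟩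
  · rintro x ⟨_, hx⟩ f hf
    exact congrFun hx ⟨f, hf⟩
  · intro h
    apply hM
    rw [FiniteDimensional, Module.Finite.iff_fg] at h ⊢
    exact Submodule.fg_of_fg_map_of_fg_inf_ker L.toLinearMap (IsNoetherian.noetherian _) h
  · intro hc
    exact hc.inter L.isClosed_ker

lemma sp_kato (T : E →L[ℝ] F) (M : Submodule ℝ E)
    (hMc : IsClosed (M : Set E)) (hM : ¬ FiniteDimensional ℝ M)
    (hT : ¬ ∃ M' ≤ M, IsClosed (M' : Set E) ∧ ¬ FiniteDimensional ℝ M' ∧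
      ∃ C : ℝ, ∀ x ∈ M', ‖x‖ ≤ C * ‖T x‖) :
    ∃ M' ≤ M, IsClosed (M' : Set E) ∧ ¬ FiniteDimensional ℝ M' ∧
      ∀ x ∈ M', ‖T x‖ ≤ (1 / 2) * ‖x‖ := by
  classical
  obtain ⟨a, ha, hr⟩ := exists_seq_of_forall_finset_exists
    (fun p : ℕ × E × (E →L[ℝ] ℝ) => p.2.1 ∈ M ∧ ‖p.2.1‖ = 1 ∧ ‖p.2.2‖ ≤ 1 ∧ p.2.2 p.2.1 = 1 ∧
      ‖T p.2.1‖ ≤ (1 / 4) ^ (p.1 + 1))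
    (fun p q => p.1 < q.1 ∧ p.2.2 q.2.1 = 0) (by
      intro s hs
      obtain ⟨M', hM'M, hker, hfd, hcl⟩ := sp_inf_ker_not_fd M hM (s.image (fun p => p.2.2))
      have hnb : ¬ ∃ C : ℝ, ∀ x ∈ M', ‖x‖ ≤ C * ‖T x‖ := fun h =>
        hT ⟨M', hM'M, hcl hMc, hfd, h⟩
      obtain ⟨x, hx, hx1, hTx⟩ := sp_small_vec T M' hnb
        ((1 / 4) ^ (s.sup (fun p => p.1) + 1 + 1)) (by positivity)
      obtain ⟨g, hg, hgx⟩ := exists_dual_vector'' ℝ x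
      refine ⟨(s.sup (fun p => p.1) + 1, x, g), ⟨hM'M hx, hx1, hg, by simpa [hx1] using hgx, hTx⟩,
        fun p hp => ⟨?_, ?_⟩⟩
      · exact Nat.lt_succ_of_le (Finset.le_sup (f := fun p : ℕ × E × (E →L[ℝ] ℝ) => p.1) hp)
      · exact hker x hx _ (Finset.mem_image_of_mem _ hp))
  set x : ℕ → E := fun n => (a n).2.1 with hxdef
  set g : ℕ → (E →L[ℝ] ℝ) := fun n => (a n).2.2 with hgdef
  have hmono : StrictMono (fun n => (a n).1) := fun m n h => (hr m n h).1
  have hxM : ∀ n, x n ∈ M := fun n => (ha n).1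
  have hx1 : ∀ n, ‖x n‖ = 1 := fun n => (ha n).2.1
  have hg1 : ∀ n, ‖g n‖ ≤ 1 := fun n => (ha n).2.2.1
  have hgx : ∀ n, g n (x n) = 1 := fun n => (ha n).2.2.2.1
  have hTx : ∀ n, ‖T (x n)‖ ≤ (1 / 4) ^ (n + 1) := fun n =>
    (ha n).2.2.2.2.trans (pow_le_pow_of_le_one (by norm_num) (by norm_num)
      (Nat.succ_le_succ (hmono.le_apply (x := n))))
  have hgx0 : ∀ m n, m < n → g m (x n) = 0 := fun m n h => (hr m n h).2
  have key : ∀ (c : ℕ → ℝ) (N n : ℕ), n < N →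
      |c n| ≤ 2 ^ n * ‖∑ i ∈ Finset.range N, c i • x i‖ := by
    intro c N n
    induction n using Nat.strong_induction_on with
    | _ n ih =>
      intro hn
      set y := ∑ i ∈ Finset.range N, c i • x i with hy
      have h1 : g n y = ∑ i ∈ Finset.range n, c i * g n (x i) + c n := by
        rw [hy, map_sum]
        simp only [map_smul, smul_eq_mul]
        have hsub : Finset.range (n + 1) ⊆ Finset.range N := by
          intro i; simp; omega
        rw [← Finset.sum_subset hsub, Finset.sum_range_succ, hgx, mul_one]
        intro i _ hi
        rw [hgx0 n i (by simpa using hi), mul_zero]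
      have h2 : |g n y| ≤ ‖y‖ := by
        have := (g n).le_opNorm y
        rw [Real.norm_eq_abs] at this
        nlinarith [norm_nonneg y, hg1 n]
      have h3 : |∑ i ∈ Finset.range n, c i * g n (x i)| ≤ ∑ i ∈ Finset.range n, 2 ^ i * ‖y‖ := by
        refine (Finset.abs_sum_le_sum_abs _ _).trans (Finset.sum_le_sum fun i hi => ?_)
        have hi' : i < n := by simpa using hi
        rw [abs_mul]
        have h4 : |g n (x i)| ≤ 1 := by
          have := (g n).le_opNorm (x i)
          rw [hx1, mul_one] at this
          exact this.trans (hg1 n)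
        have := ih i hi' (by omega)
        nlinarith [abs_nonneg (c i), abs_nonneg (g n (x i))]
      have h5 : ∑ i ∈ Finset.range n, (2 : ℝ) ^ i * ‖y‖ = (2 ^ n - 1) * ‖y‖ := by
        rw [← Finset.sum_mul, geom_sum_eq (by norm_num)]
        norm_num
      have h6 : c n = g n y - ∑ i ∈ Finset.range n, c i * g n (x i) := by linarith
      rw [h6]
      refine (abs_sub _ _).trans ?_
      rw [h5] at h3
      linarith
  have hfs : ∀ c : ℕ →₀ ℝ, ∃ N, (∀ n, N ≤ n → c n = 0) ∧
      Finsupp.linearCombination ℝ x c = ∑ i ∈ Finset.range N, c i • x i := by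
    intro c
    have hlt : ∀ i ∈ c.support, i < c.support.sup id + 1 := fun i hi =>
      Nat.lt_succ_of_le (Finset.le_sup (f := id) hi)
    refine ⟨c.support.sup id + 1, fun n hn => ?_, ?_⟩
    · by_contra h
      have := hlt n (Finsupp.mem_support_iff.2 h)
      omega
    · rw [Finsupp.linearCombination_apply, Finsupp.sum_of_support_subset]
      · intro i hi
        exact Finset.mem_range.2 (hlt i hi)
      · simp
  have li : LinearIndependent ℝ x := by
    rw [linearIndependent_iff]
    intro c hc
    obtain ⟨N, hN, he⟩ := hfs c
    ext n
    by_cases hn : n < N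
    · have := key c N n hn
      rw [← he, hc, norm_zero, mul_zero] at this
      simpa using this
    · exact hN n (by omega)
  refine ⟨(Submodule.span ℝ (Set.range x)).topologicalClosure, ?_,
    Submodule.isClosed_topologicalClosure _, ?_, ?_⟩
  · apply Submodule.topologicalClosure_minimal _ _ hMc
    rw [Submodule.span_le]
    rintro _ ⟨n, rfl⟩
    exact hxM n
  · exact sp_not_fd_of_linInd _ x (fun n => Submodule.le_topologicalClosure _
      (Submodule.subset_span ⟨n, rfl⟩)) li
  · have hclosed : IsClosed {y : E | ‖T y‖ ≤ (1 / 2) * ‖y‖} :=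
      isClosed_le (by fun_prop) (by fun_prop)
    have hsub : ((Submodule.span ℝ (Set.range x) : Submodule ℝ E) : Set E) ⊆
        {y : E | ‖T y‖ ≤ (1 / 2) * ‖y‖} := by
      intro y hy
      obtain ⟨c, rfl⟩ := Finsupp.mem_span_range_iff_exists_finsupp.1 hy
      obtain ⟨N, hN, he⟩ := hfs c
      rw [Finsupp.linearCombination_apply] at he
      rw [he]
      set y := ∑ i ∈ Finset.range N, c i • x i with hy
      have h1 : ‖T y‖ ≤ ∑ i ∈ Finset.range N, (1 / 4) * (1 / 2) ^ i * ‖y‖ := by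
        rw [hy, map_sum]
        refine (norm_sum_le _ _).trans (Finset.sum_le_sum fun i hi => ?_)
        rw [map_smul, norm_smul, Real.norm_eq_abs]
        have h2 := key c N i (Finset.mem_range.1 hi)
        rw [← hy] at h2 ⊢
        calc |c i| * ‖T (x i)‖ ≤ (2 ^ i * ‖y‖) * (1 / 4) ^ (i + 1) :=
              mul_le_mul h2 (hTx i) (norm_nonneg _) (by positivity)
          _ = 1 / 4 * (2 * (1 / 4)) ^ i * ‖y‖ := by rw [mul_pow]; ring
          _ = _ := by norm_num
      have h3 : ∑ i ∈ Finset.range N, (1 / 4 : ℝ) * (1 / 2) ^ i * ‖y‖ ≤ (1 / 2) * ‖y‖ := by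
        rw [← Finset.sum_mul, ← Finset.mul_sum]
        gcongr
        have := sum_geometric_two_le N
        linarith
      exact h1.trans h3
    intro y hy
    exact closure_minimal hsub hclosed hy

end transfer

lemma sp_perturb {E : Type*} [NormedAddCommGroup E] [NormedSpace ℝ E] [CompleteSpace E]
    (M : Submodule ℝ E) (hM : IsClosed (M : Set E)) (h f : ℕ → E) (a : ℕ → E →L[ℝ] ℝ)
    (bi : ∀ n m, a n (h m) = if n = m then 1 else 0)
    (hsum : ∀ x, Summable (fun n => a n x • h n)) (C : ℝ)
    (hbd : ∀ x, ‖∑' n, a n x • h n‖ ≤ C * ‖x‖) (hf : ∀ n, f n ∈ M)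
    (hd : ∀ n, ‖a n‖ * ‖h n - f n‖ ≤ (1 / 4) * (1 / 2) ^ n) : SpGood M := by
  let L : E →ₗ[ℝ] E :=
    { toFun := fun x => ∑' n, a n x • h n
      map_add' := fun x y => by
        rw [← (hsum x).tsum_add (hsum y)]
        simp [add_smul]
      map_smul' := fun c x => by
        rw [RingHom.id_apply, ← (hsum x).tsum_const_smul c]
        simp [mul_smul] }
  let P : E →L[ℝ] E := L.mkContinuous C hbd
  have hP : ∀ x, P x = ∑' n, a n x • h n := fun x => rfl
  have hPh : ∀ m, P (h m) = h m := by
    intro m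
    rw [hP, tsum_eq_single m]
    · simp [bi]
    · intro n hn
      simp [bi, hn]
  have hgeo : HasSum (fun n : ℕ => (1 / 4 : ℝ) * (1 / 2) ^ n) (1 / 2) := by
    have := hasSum_geometric_two.mul_left (1 / 4 : ℝ)
    norm_num at this ⊢
    exact this
  have hn : ∀ n, ‖(a n).smulRight (h n - f n)‖ ≤ (1 / 4) * (1 / 2) ^ n := fun n => by
    rw [ContinuousLinearMap.norm_smulRight_apply]
    exact hd n
  have hsV : Summable (fun n => (a n).smulRight (h n - f n)) :=
    Summable.of_norm_bounded hgeo.summable hn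
  let V : E →L[ℝ] E := ∑' n, (a n).smulRight (h n - f n)
  have hV : ‖V‖ < 1 := (tsum_of_norm_bounded hgeo hn).trans_lt (by norm_num)
  have hVx : ∀ x, V x = ∑' n, a n x • (h n - f n) := fun x => by
    have := ContinuousLinearMap.hasSum (ContinuousLinearMap.apply ℝ E x) hsV.hasSum
    simpa using this.tsum_eq.symm
  have hVh : ∀ m, V (h m) = h m - f m := by
    intro m
    rw [hVx, tsum_eq_single m]
    · simp [bi]
    · intro n hn
      simp [bi, hn]
  obtain ⟨u, hu⟩ := isUnit_one_sub_of_norm_lt_one hV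
  set U : E →L[ℝ] E := ↑u with hU
  set W : E →L[ℝ] E := ↑(u⁻¹) with hW
  have hUW : ∀ x, U (W x) = x := fun x => by
    have : U * W = 1 := u.mul_inv
    exact congrArg (fun A : E →L[ℝ] E => A x) this
  have hWU : ∀ x, W (U x) = x := fun x => by
    have : W * U = 1 := u.inv_mul
    exact congrArg (fun A : E →L[ℝ] E => A x) this
  have hUh : ∀ m, U (h m) = f m := fun m => by
    rw [hu]
    simp [hVh]
  have hUP : ∀ x, U (P x) = ∑' n, a n x • f n := fun x => by
    have := U.hasSum (hsum x).hasSum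
    rw [hP, ← this.tsum_eq]
    simp [hUh]
  have hPP : ∀ x, P (P x) = P x := fun x => by
    have := P.hasSum (hsum x).hasSum
    rw [← hP] at this
    rw [← this.tsum_eq]
    simp only [map_smul, hPh]
    rw [hP]
  refine ⟨U.comp (P.comp W), fun x => ?_, fun x => ?_, ?_⟩
  · simp [hWU, hPP]
  · simp only [ContinuousLinearMap.comp_apply, hUP]
    exact tsum_mem hM fun n => M.smul_mem _ (hf n)
  · have lih : LinearIndependent ℝ h := by
      rw [linearIndependent_iff']
      intro s c hc i hi
      have := congrArg (a i) hc
      simpa [bi, hi] using this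
    have lif : LinearIndependent ℝ f := by
      have := lih.map' U.toLinearMap (LinearMap.ker_eq_bot.2 (Function.LeftInverse.injective hWU))
      have e : f = U.toLinearMap ∘ h := funext fun m => (hUh m).symm
      rw [e]
      exact this
    refine sp_not_fd_of_linInd _ f (fun n => ⟨f n, ?_⟩) lif
    simp only [ContinuousLinearMap.coe_coe, ContinuousLinearMap.comp_apply]
    rw [← hUh n, hWU, hPh]

section block
variable {X K : Type*} [NormedAddCommGroup X] [NormedSpace ℝ X]
  [TopologicalSpace K] [CompactSpace K]

lemma sp_disj_sum (h : ℕ → C(K, X)) (hdis : ∀ n m, n ≠ m → ∀ t, h n t = 0 ∨ h m t = 0)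
    (h1 : ∀ n, ‖h n‖ ≤ 1) (c : ℕ → ℝ) (s : Finset ℕ) (B : ℝ) (hB : 0 ≤ B)
    (hc : ∀ n ∈ s, |c n| ≤ B) : ‖∑ n ∈ s, c n • h n‖ ≤ B := by
  rw [ContinuousMap.norm_le _ hB]
  intro t
  have hcoe : (∑ n ∈ s, c n • h n) t = ∑ n ∈ s, c n • h n t := by
    simp [ContinuousMap.coe_sum]
  rw [hcoe]
  by_cases hex : ∃ m ∈ s, h m t ≠ 0
  · obtain ⟨m, hm, hmt⟩ := hex
    rw [Finset.sum_eq_single m]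
    · rw [norm_smul, Real.norm_eq_abs]
      have h2 : ‖h m t‖ ≤ 1 := ((h m).norm_coe_le_norm t).trans (h1 m)
      nlinarith [hc m hm, abs_nonneg (c m), norm_nonneg (h m t)]
    · intro n _ hn
      rcases hdis n m hn t with h0 | h0
      · simp [h0]
      · exact absurd h0 hmt
    · intro h; exact absurd hm h
  · push Not at hex
    rw [Finset.sum_eq_zero]
    · simpa using hB
    · intro n hn
      simp [hex n hn]

lemma sp_block [CompleteSpace X] [SeqCompactSpace K] (M : Submodule ℝ C(K, X)) (hM : IsClosed (M : Set C(K, X)))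
    (h f : ℕ → C(K, X)) (hdis : ∀ n m, n ≠ m → ∀ t, h n t = 0 ∨ h m t = 0)
    (h1 : ∀ n, ‖h n‖ ≤ 1) (h2 : ∀ n, 1 / 2 ≤ ‖h n‖) (hf : ∀ n, f n ∈ M)
    (hd : ∀ n, ‖h n - f n‖ ≤ (1 / 16) * (1 / 2) ^ n) : SpGood M := by
  have hk : ∀ n, ∃ t, ‖h n t‖ = ‖h n‖ := by
    intro n
    have hne : Nonempty K := by
      by_contra hne
      rw [not_nonempty_iff] at hne
      have : h n = 0 := by ext t; exact hne.elim t
      have := h2 n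
      simp_all
      norm_num at this
    obtain ⟨t, -, ht⟩ := isCompact_univ.exists_isMaxOn (Set.univ_nonempty (α := K))
      (f := fun t => ‖h n t‖) (by fun_prop)
    refine ⟨t, le_antisymm ((h n).norm_coe_le_norm t) ?_⟩
    rw [ContinuousMap.norm_le _ (norm_nonneg _)]
    intro s
    exact ht (Set.mem_univ s)
  choose k hk using hk
  have hy : ∀ n, ∃ y : X →L[ℝ] ℝ, ‖y‖ ≤ 2 ∧ y (h n (k n)) = 1 := by
    intro n
    obtain ⟨g, hg, hgx⟩ := exists_dual_vector'' ℝ (h n (k n))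
    have hpos : 0 < ‖h n‖ := lt_of_lt_of_le (by norm_num) (h2 n)
    refine ⟨‖h n‖⁻¹ • g, ?_, ?_⟩
    · rw [norm_smul, norm_inv, norm_norm, inv_mul_le_iff₀ hpos]
      linarith [h2 n]
    · simp [hgx, hk, hpos.ne']
  choose y hy2 hy1 using hy
  obtain ⟨k0, σ, hσ, hlim⟩ := SeqCompactSpace.tendsto_subseq k
  have hk0 : ∀ m, h m k0 = 0 := by
    intro m
    have ht : Tendsto (fun n => h m (k (σ n))) atTop (𝓝 (h m k0)) :=
      ((h m).continuous.tendsto k0).comp hlim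
    refine tendsto_nhds_unique ht (tendsto_const_nhds.congr' ?_)
    filter_upwards [eventually_gt_atTop m] with n hn
    have hne : σ n ≠ m := by
      have := hσ.le_apply (x := n)
      omega
    rcases hdis _ _ hne (k (σ n)) with h0 | h0
    · have := hy1 (σ n)
      simp [h0] at this
    · exact h0.symm
  let a : ℕ → C(K, X) →L[ℝ] ℝ := fun n =>
    (y (σ n)).comp (ContinuousMap.evalCLM ℝ (k (σ n)) - ContinuousMap.evalCLM ℝ k0)
  have ha : ∀ n x, a n x = y (σ n) (x (k (σ n)) - x k0) := fun n x => rfl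
  have habs : ∀ n x, |a n x| ≤ 2 * ‖x (k (σ n)) - x k0‖ := fun n x => by
    rw [ha, ← Real.norm_eq_abs]
    exact ((y (σ n)).le_opNorm _).trans (by gcongr; exact hy2 _)
  have habs4 : ∀ n x, |a n x| ≤ 4 * ‖x‖ := fun n x => by
    refine (habs n x).trans ?_
    have := norm_sub_le (x (k (σ n))) (x k0)
    have := x.norm_coe_le_norm (k (σ n))
    have := x.norm_coe_le_norm k0
    linarith
  have hdis' : ∀ n m, n ≠ m → ∀ t, h (σ n) t = 0 ∨ h (σ m) t = 0 := fun n m hnm =>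
    hdis _ _ (fun e => hnm (hσ.injective e))
  have hsum : ∀ x, Summable (fun n => a n x • h (σ n)) := by
    intro x
    rw [summable_iff_vanishing_norm]
    intro ε hε
    have ht : Tendsto (fun n => 2 * ‖x (k (σ n)) - x k0‖) atTop (𝓝 0) := by
      have h3 : Tendsto (fun n => x (k (σ n))) atTop (𝓝 (x k0)) :=
        (x.continuous.tendsto k0).comp hlim
      have h4 := ((h3.sub_const (x k0)).norm).const_mul 2
      simpa using h4
    obtain ⟨N, hN⟩ := eventually_atTop.1 (ht.eventually (gt_mem_nhds (half_pos hε)))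
    refine ⟨Finset.range N, fun s hs => ?_⟩
    refine (sp_disj_sum (fun n => h (σ n)) hdis' (fun n => h1 _) (fun n => a n x) s (ε / 2)
      (half_pos hε).le ?_).trans_lt (half_lt_self hε)
    intro n hn
    have : N ≤ n := by
      by_contra hlt
      exact (Finset.disjoint_left.1 hs hn) (Finset.mem_range.2 (not_le.1 hlt))
    exact (habs n x).trans (hN n this).le
  refine sp_perturb M hM (fun n => h (σ n)) (fun n => f (σ n)) a ?_ hsum 4 ?_ (fun n => hf _) ?_
  · intro n m
    rw [ha, hk0, sub_zero]
    split_ifs with e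
    · subst e
      exact hy1 _
    · rcases hdis' n m e (k (σ n)) with h0 | h0
      · have := hy1 (σ n)
        simp [h0] at this
      · simp [h0]
  · intro x
    refine le_of_tendsto (hsum x).hasSum.norm (Eventually.of_forall fun s => ?_)
    exact sp_disj_sum (fun n => h (σ n)) hdis' (fun n => h1 _) (fun n => a n x) s _
      (by positivity) (fun n _ => habs4 n x)
  · intro n
    have hna : ‖a n‖ ≤ 4 := ContinuousLinearMap.opNorm_le_bound _ (by norm_num) (habs4 n)
    have h3 : ‖h (σ n) - f (σ n)‖ ≤ (1 / 16) * (1 / 2) ^ n := by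
      refine (hd _).trans ?_
      gcongr ?_ * ?_
      exact pow_le_pow_of_le_one (by norm_num) (by norm_num) hσ.le_apply
    exact (mul_le_mul hna h3 (norm_nonneg _) (by norm_num)).trans (le_of_eq (by ring))

end block

section ordinal
variable {X K : Type*} [NormedAddCommGroup X] [NormedSpace ℝ X]
  [TopologicalSpace K] [CompactSpace K] {l : Ordinal}

/-- `f` is constant on the fibres of `φ` and vanishes where `ν ≤ φ`. -/
def SpZ (φ : C(K, Set.Iic l)) (ν : Ordinal) (f : C(K, X)) : Prop :=
  (∀ s t, φ s = φ t → f s = f t) ∧ ∀ t, ν ≤ (φ t).1 → f t = 0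

lemma sp_clopen (φ : C(K, Set.Iic l)) (ν : Ordinal) : IsClopen {t : K | (φ t).1 ≤ ν} := by
  have hc : Continuous fun t : K => (φ t).1 := continuous_subtype_val.comp φ.continuous
  refine ⟨isClosed_Iic.preimage hc, ?_⟩
  have : {t : K | (φ t).1 ≤ ν} = (fun t => (φ t).1) ⁻¹' Set.Iio (Order.succ ν) := by
    ext t
    simp
  rw [this]
  exact isOpen_Iio.preimage hc

/-- multiplication by the indicator of `φ ≤ ν`. -/
noncomputable def spQ (X : Type*) [NormedAddCommGroup X] [NormedSpace ℝ X]
    (φ : C(K, Set.Iic l)) (ν : Ordinal) : C(K, X) →L[ℝ] C(K, X) :=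
  LinearMap.mkContinuous
    { toFun := fun f => ⟨Set.indicator {t : K | (φ t).1 ≤ ν} f,
        (sp_clopen φ ν).continuous_indicator f.continuous⟩
      map_add' := fun f g => by
        ext t
        exact congrFun (Set.indicator_add _ (f : K → X) (g : K → X)) t
      map_smul' := fun c f => by
        ext t
        exact congrFun (Set.indicator_const_smul _ c (f : K → X)) t } 1 (fun f => by
      rw [one_mul, ContinuousMap.norm_le _ (norm_nonneg _)]
      intro t
      exact (norm_indicator_le_norm_self _ _).trans (f.norm_coe_le_norm t))

lemma spQ_of_le (φ : C(K, Set.Iic l)) (ν : Ordinal) (f : C(K, X)) (t : K)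
    (h : (φ t).1 ≤ ν) : spQ X φ ν f t = f t :=
  Set.indicator_of_mem (s := {t : K | (φ t).1 ≤ ν}) h f

lemma spQ_of_lt (φ : C(K, Set.Iic l)) (ν : Ordinal) (f : C(K, X)) (t : K)
    (h : ν < (φ t).1) : spQ X φ ν f t = 0 :=
  Set.indicator_of_notMem (s := {t : K | (φ t).1 ≤ ν}) (by simpa using h) f

lemma spQ_norm_mono (φ : C(K, Set.Iic l)) {ν ν' : Ordinal} (h : ν ≤ ν') (f : C(K, X)) :
    ‖spQ X φ ν f‖ ≤ ‖spQ X φ ν' f‖ := by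
  rw [ContinuousMap.norm_le _ (norm_nonneg _)]
  intro t
  by_cases ht : (φ t).1 ≤ ν
  · rw [spQ_of_le _ _ _ _ ht, ← spQ_of_le φ ν' f t (ht.trans h)]
    exact ContinuousMap.norm_coe_le_norm _ _
  · rw [spQ_of_lt _ _ _ _ (not_le.1 ht), norm_zero]
    exact norm_nonneg _

lemma spQ_mem (φ : C(K, Set.Iic l)) (ν : Ordinal) (f : C(K, X))
    (hf : ∀ s t, φ s = φ t → f s = f t) : SpZ φ (ν + 1) (spQ X φ ν f) := by
  refine ⟨fun s t hst => ?_, fun t ht => spQ_of_lt _ _ _ _ (Order.add_one_le_iff.1 ht)⟩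
  by_cases hs : (φ s).1 ≤ ν
  · rw [spQ_of_le _ _ _ _ hs, spQ_of_le _ _ _ _ (hst ▸ hs), hf s t hst]
  · rw [spQ_of_lt _ _ _ _ (not_le.1 hs), spQ_of_lt _ _ _ _ (not_le.1 (hst ▸ hs))]

/-- tails are small. -/
lemma sp_tail (φ : C(K, Set.Iic l)) (μ : Ordinal) (hμ : 0 < μ) (f : C(K, X)) (hf : SpZ φ μ f)
    (ε : ℝ) (hε : 0 < ε) : ∃ ν < μ, ∀ t, ν < (φ t).1 → ‖f t‖ ≤ ε := by
  have hc : Continuous fun t : K => (φ t).1 := continuous_subtype_val.comp φ.continuous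
  have hcl : IsClosed {t : K | ε ≤ ‖f t‖} := isClosed_le (by fun_prop) (by fun_prop)
  by_cases hne : {t : K | ε ≤ ‖f t‖}.Nonempty
  · obtain ⟨t, ht, hmax⟩ := hcl.isCompact.exists_isMaxOn hne hc.continuousOn
    refine ⟨(φ t).1, ?_, fun s hs => ?_⟩
    · by_contra hlt
      have h0 := hf.2 t (not_lt.1 hlt)
      have : ε ≤ ‖f t‖ := ht
      rw [h0, norm_zero] at this
      linarith
    · by_contra hlt
      have : (φ s).1 ≤ (φ t).1 := hmax (show s ∈ {t : K | ε ≤ ‖f t‖} from (not_le.1 hlt).le)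
      exact absurd hs (not_lt.2 this)
  · refine ⟨0, hμ, fun s _ => ?_⟩
    by_contra hlt
    exact hne ⟨s, (not_le.1 hlt).le⟩

lemma sp_limit [CompleteSpace X] [SeqCompactSpace K] (φ : C(K, Set.Iic l)) (μ : Ordinal)
    (hμ : Order.IsSuccLimit μ)
    (M : Submodule ℝ C(K, X)) (hMc : IsClosed (M : Set C(K, X)))
    (hMZ : ∀ f ∈ M, SpZ φ μ f)
    (hT : ∀ ν < μ, ¬ ∃ C : ℝ, ∀ x ∈ M, ‖x‖ ≤ C * ‖spQ X φ ν x‖) : SpGood M := by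
  classical
  have hμ0 : 0 < μ := hμ.bot_lt
  obtain ⟨a, ha, hr⟩ := exists_seq_of_forall_finset_exists
    (fun p : ℕ × C(K, X) × Ordinal => p.2.1 ∈ M ∧ ‖p.2.1‖ = 1 ∧ p.2.2 < μ ∧
      ∀ t, p.2.2 < (φ t).1 → ‖p.2.1 t‖ ≤ (1 / 64) * (1 / 2) ^ p.1)
    (fun p q => p.1 < q.1 ∧ p.2.2 < q.2.2 ∧ ‖spQ X φ p.2.2 q.2.1‖ ≤ (1 / 64) * (1 / 2) ^ q.1) (by
      intro s hs
      have hν0 : s.sup (fun p => p.2.2) < μ := (Finset.sup_lt_iff hμ0).2 fun p hp => (hs p hp).2.2.1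
      set ν0 := s.sup (fun p => p.2.2)
      set k := s.sup (fun p => p.1) + 1
      have hε : (0 : ℝ) < (1 / 64) * (1 / 2) ^ k := by positivity
      obtain ⟨f, hf, hf1, hQ⟩ := sp_small_vec _ M (hT ν0 hν0) _ hε
      obtain ⟨ν, hν, hνf⟩ := sp_tail φ μ hμ0 f (hMZ f hf) _ hε
      refine ⟨(k, f, max ν (Order.succ ν0)), ⟨hf, hf1, max_lt hν (hμ.succ_lt hν0),
        fun t ht => hνf t ((le_max_left _ _).trans_lt ht)⟩, fun p hp => ⟨?_, ?_, ?_⟩⟩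
      · exact Nat.lt_succ_of_le (Finset.le_sup (f := fun p : ℕ × C(K, X) × Ordinal => p.1) hp)
      · exact (Order.lt_succ_of_le (Finset.le_sup
          (f := fun p : ℕ × C(K, X) × Ordinal => p.2.2) hp)).trans_le (le_max_right _ _)
      · exact (spQ_norm_mono φ (Finset.le_sup
          (f := fun p : ℕ × C(K, X) × Ordinal => p.2.2) hp) f).trans hQ)
  set ν : ℕ → Ordinal := fun n => (a n).2.2 with hνdef
  have hk : StrictMono (fun n => (a n).1) := fun m n h => (hr m n h).1
  have hν : StrictMono ν := fun m n h => (hr m n h).2.1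
  have hε : ∀ n, (1 / 64 : ℝ) * (1 / 2) ^ (a n).1 ≤ (1 / 64) * (1 / 2) ^ n := fun n => by
    gcongr ?_ * ?_
    exact pow_le_pow_of_le_one (by norm_num) (by norm_num) (hk.le_apply (x := n))
  set f : ℕ → C(K, X) := fun n => (a (n + 1)).2.1 with hfdef
  let h : ℕ → C(K, X) := fun n => spQ X φ (ν (n + 1)) (f n) - spQ X φ (ν n) (f n)
  have hf1 : ∀ n, ‖f n‖ = 1 := fun n => (ha (n + 1)).2.1
  have hlow : ∀ n t, (φ t).1 ≤ ν n → h n t = 0 ∧ ‖f n t‖ ≤ (1 / 64) * (1 / 2) ^ n := by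
    intro n t ht
    constructor
    · simp only [h, ContinuousMap.sub_apply]
      rw [spQ_of_le _ _ _ _ ht, spQ_of_le _ _ _ _ (ht.trans (hν (Nat.lt_succ_self n)).le),
        sub_self]
    · rw [← spQ_of_le φ (ν n) (f n) t ht]
      refine (ContinuousMap.norm_coe_le_norm _ t).trans
        (((hr n (n + 1) (Nat.lt_succ_self n)).2.2).trans ((hε _).trans ?_))
      gcongr ?_ * ?_
      exact pow_le_pow_of_le_one (by norm_num) (by norm_num) (Nat.le_succ n)
  have hmid : ∀ n t, ν n < (φ t).1 → (φ t).1 ≤ ν (n + 1) → h n t = f n t := by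
    intro n t h1 h2
    simp only [h, ContinuousMap.sub_apply]
    rw [spQ_of_le _ _ _ _ h2, spQ_of_lt _ _ _ _ h1, sub_zero]
  have hhigh : ∀ n t, ν (n + 1) < (φ t).1 → h n t = 0 ∧ ‖f n t‖ ≤ (1 / 64) * (1 / 2) ^ n := by
    intro n t ht
    constructor
    · simp only [h, ContinuousMap.sub_apply]
      rw [spQ_of_lt _ _ _ _ ht, spQ_of_lt _ _ _ _ ((hν (Nat.lt_succ_self n)).trans ht),
        sub_self]
    · refine ((ha (n + 1)).2.2.2 t ht).trans ((hε _).trans ?_)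
      gcongr ?_ * ?_
      exact pow_le_pow_of_le_one (by norm_num) (by norm_num) (Nat.le_succ n)
  have hcases : ∀ n t, (h n t = 0 ∧ ‖f n t‖ ≤ (1 / 64) * (1 / 2) ^ n) ∨ h n t = f n t := by
    intro n t
    rcases le_or_gt (φ t).1 (ν n) with h1 | h1
    · exact Or.inl (hlow n t h1)
    · rcases le_or_gt (φ t).1 (ν (n + 1)) with h2 | h2
      · exact Or.inr (hmid n t h1 h2)
      · exact Or.inl (hhigh n t h2)
  have hd : ∀ n, ‖h n - f n‖ ≤ (1 / 16) * (1 / 2) ^ n := by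
    intro n
    have hp : (0 : ℝ) < (1 / 2) ^ n := by positivity
    rw [ContinuousMap.norm_le _ (by positivity)]
    intro t
    rw [ContinuousMap.sub_apply]
    rcases hcases n t with ⟨h0, h1⟩ | h0
    · rw [h0, zero_sub, norm_neg]
      linarith
    · rw [h0, sub_self, norm_zero]
      positivity
  have hdlt : ∀ n m, n < m → ∀ t, h n t = 0 ∨ h m t = 0 := by
    intro n m hnm t
    rcases le_or_gt (φ t).1 (ν m) with h1 | h1
    · exact Or.inr (hlow m t h1).1
    · exact Or.inl (hhigh n t ((hν.monotone hnm).trans_lt h1)).1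
  refine sp_block M hMc h f ?_ ?_ ?_ (fun n => (ha (n + 1)).1) hd
  · intro n m hnm t
    rcases lt_or_gt_of_ne hnm with hlt | hlt
    · exact hdlt n m hlt t
    · exact (hdlt m n hlt t).symm
  · intro n
    rw [ContinuousMap.norm_le _ zero_le_one]
    intro t
    rcases hcases n t with ⟨h0, h1⟩ | h0
    · rw [h0, norm_zero]
      exact zero_le_one
    · rw [h0, ← hf1 n]
      exact (f n).norm_coe_le_norm t
  · intro n
    have h3 := norm_sub_norm_le (f n) (h n)
    rw [norm_sub_rev (f n) (h n), hf1] at h3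
    have h4 : (1 / 2 : ℝ) ^ n ≤ 1 := pow_le_one₀ (by norm_num) (by norm_num)
    linarith [hd n]

lemma sp_succ [CompleteSpace X] (hX : Subprojective X) (φ : C(K, Set.Iic l)) (ν : Ordinal)
    (k : K) (hk : (φ k).1 = ν)
    (M : Submodule ℝ C(K, X)) (hMc : IsClosed (M : Set C(K, X))) (hM : ¬ FiniteDimensional ℝ M)
    (hMZ : ∀ f ∈ M, SpZ φ (ν + 1) f)
    (ih : ∀ M' : Submodule ℝ C(K, X), IsClosed (M' : Set C(K, X)) → ¬ FiniteDimensional ℝ M' →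
      (∀ f ∈ M', SpZ φ ν f) → SpGood M') : SpGood M := by
  let T : C(K, X) →L[ℝ] X := ContinuousMap.evalCLM ℝ k
  have hTf : ∀ f, T f = f k := fun f => rfl
  by_cases hT : ∃ M' ≤ M, IsClosed (M' : Set C(K, X)) ∧ ¬ FiniteDimensional ℝ M' ∧
      ∃ C : ℝ, ∀ x ∈ M', ‖x‖ ≤ C * ‖T x‖
  · obtain ⟨M', hle, hc, hfd, C, hC⟩ := hT
    refine SpGood.mono hle (sp_map_good T M' C hC ?_)
    obtain ⟨N, h1, -, h2, h3⟩ := hX _ (sp_map_closed T M' hc C hC) (sp_map_not_fd T M' hfd C hC)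
    exact SpGood.of_compl h1 h2 h3
  · obtain ⟨M', hle, hc, hfd, hsmall⟩ := sp_kato T M hMc hM hT
    let cst : X →L[ℝ] C(K, X) := LinearMap.mkContinuous
      { toFun := fun x => ContinuousMap.const K x
        map_add' := fun x y => by ext t; simp
        map_smul' := fun c x => by ext t; simp } 1 (fun x => by
          rw [one_mul, ContinuousMap.norm_le _ (norm_nonneg _)]
          intro t
          exact le_rfl)
    let R : C(K, X) →L[ℝ] C(K, X) :=
      (spQ X φ ν).comp (ContinuousLinearMap.id ℝ _ - cst.comp T)
    have hRle : ∀ f t, (φ t).1 ≤ ν → R f t = f t - f k := fun f t ht =>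
      spQ_of_le φ ν _ t ht
    have hRlt : ∀ f t, ν < (φ t).1 → R f t = 0 := fun f t ht => spQ_of_lt φ ν _ t ht
    have hb : ∀ f ∈ M', ‖f‖ ≤ 2 * ‖R f‖ := by
      intro f hf
      have h1 : ‖f‖ ≤ ‖R f‖ + ‖f k‖ := by
        rw [ContinuousMap.norm_le _ (by positivity)]
        intro t
        by_cases ht : (φ t).1 ≤ ν
        · have h2 : f t = R f t + f k := by rw [hRle f t ht]; simp
          rw [h2]
          refine (norm_add_le _ _).trans ?_
          gcongr
          exact (R f).norm_coe_le_norm t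
        · rw [(hMZ f (hle hf)).2 t (Order.add_one_le_iff.2 (not_le.1 ht)), norm_zero]
          positivity
      have h2 := hsmall f hf
      rw [hTf] at h2
      linarith
    refine SpGood.mono hle (sp_map_good R M' 2 hb (ih _ (sp_map_closed R M' hc 2 hb)
      (sp_map_not_fd R M' hfd 2 hb) ?_))
    rintro _ ⟨f, hf, rfl⟩
    have hZ := hMZ f (hle hf)
    change SpZ φ ν (R f)
    refine ⟨fun s t hst => ?_, fun t ht => ?_⟩
    · by_cases hs : (φ s).1 ≤ ν
      · rw [hRle f s hs, hRle f t (hst ▸ hs), hZ.1 s t hst]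
      · rw [hRlt f s (not_le.1 hs), hRlt f t (not_le.1 (hst ▸ hs))]
    · rcases ht.eq_or_lt with h | h
      · rw [hRle f t h.ge, hZ.1 t k (Subtype.ext (by rw [hk, h])), sub_self]
      · exact hRlt f t h

lemma sp_main [CompleteSpace X] [SeqCompactSpace K] (hX : Subprojective X)
    (φ : C(K, Set.Iic l)) (hφ : Function.Surjective φ) (μ : Ordinal) :
    μ ≤ l → ∀ M : Submodule ℝ C(K, X), IsClosed (M : Set C(K, X)) → ¬ FiniteDimensional ℝ M →
      (∀ f ∈ M, SpZ φ μ f) → SpGood M := by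
  induction μ using Ordinal.limitRecOn with
  | zero =>
    intro _ M _ hM hMZ
    exfalso
    apply hM
    have : M = ⊥ := by
      rw [eq_bot_iff]
      intro f hf
      rw [Submodule.mem_bot]
      ext t
      exact (hMZ f hf).2 t zero_le
    rw [this]
    infer_instance
  | add_one ν ih =>
    intro hl M hMc hM hMZ
    have hνl : ν ≤ l := (Order.le_succ ν).trans hl
    obtain ⟨k, hk⟩ := hφ ⟨ν, hνl⟩
    exact sp_succ hX φ ν k (by rw [hk]) M hMc hM hMZ (ih hνl)
  | limit μ hμ ih =>
    intro hl M hMc hM hMZ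
    by_cases hT : ∃ ν < μ, ∃ C : ℝ, ∀ x ∈ M, ‖x‖ ≤ C * ‖spQ X φ ν x‖
    · obtain ⟨ν, hν, C, hC⟩ := hT
      have hν1 : ν + 1 < μ := hμ.add_one_lt hν
      refine sp_map_good (spQ X φ ν) M C hC (ih (ν + 1) hν1 (hν1.le.trans hl) _
        (sp_map_closed _ M hMc C hC) (sp_map_not_fd _ M hM C hC) ?_)
      rintro _ ⟨f, hf, rfl⟩
      exact spQ_mem φ ν f (hMZ f hf).1
    · push Not at hT
      refine sp_limit φ μ hμ M hMc hMZ fun ν hν => ?_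
      rintro ⟨C, hC⟩
      obtain ⟨x, hx, hlt⟩ := hT ν hν C
      exact absurd (hC x hx) (not_le.2 hlt)

lemma sp_mem_iff (φ : C(K, Set.Iic l)) (hφ : Function.Surjective φ) (f : C(K, X)) :
    f ∈ compSubmodule0 X φ ↔ SpZ φ l f := by
  constructor
  · rintro ⟨g, rfl, hg⟩
    refine ⟨fun s t hst => by simp [hst], fun t ht => ?_⟩
    have : φ t = ⟨l, Set.mem_Iic.mpr le_rfl⟩ := Subtype.ext (le_antisymm (φ t).2 ht)
    rw [ContinuousMap.comp_apply, this, hg]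
  · rintro ⟨h1, h2⟩
    have hq : IsQuotientMap φ := φ.continuous.isClosedMap.isQuotientMap φ.continuous hφ
    have hcomp := hq.lift_comp f (fun a b h => h1 a b h)
    refine ⟨hq.lift f (fun a b h => h1 a b h), hcomp.symm, ?_⟩
    obtain ⟨k, hk⟩ := hφ ⟨l, Set.mem_Iic.mpr le_rfl⟩
    have := congrArg (fun g : C(K, X) => g k) hcomp
    simp only [ContinuousMap.comp_apply] at this
    rw [← hk]
    refine this.trans (h2 k ?_)
    rw [hk]

end ordinal

theorem subprojectiveWrt_compSubmodule0
    (X : Type*) [NormedAddCommGroup X] [NormedSpace ℝ X] [CompleteSpace X]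
    (hX : Subprojective X) (l : Ordinal)
    (K : Type*) [TopologicalSpace K] [CompactSpace K] [T2Space K] [SeqCompactSpace K]
    (φ : C(K, Set.Iic l)) (hφ : Function.Surjective φ) :
    IsClosed ((compSubmodule0 X φ : Submodule ℝ C(K, X)) : Set C(K, X)) ∧
      SubprojectiveWrt (compSubmodule0 X φ) := by
  have hset : ((compSubmodule0 X φ : Submodule ℝ C(K, X)) : Set C(K, X)) =
      {f | SpZ φ l f} := Set.ext fun f => sp_mem_iff φ hφ f
  refine ⟨?_, fun M hMZ hMc hM => (sp_main hX φ hφ l le_rfl M hMc hM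
    fun f hf => (sp_mem_iff φ hφ f).1 (hMZ hf)).exists_compl⟩
  rw [hset]
  have hev : ∀ t : K, Continuous fun f : C(K, X) => f t := fun t =>
    (ContinuousMap.evalCLM ℝ t : C(K, X) →L[ℝ] X).continuous
  refine IsClosed.inter (s₁ := {f : C(K, X) | ∀ s t, φ s = φ t → f s = f t})
    (s₂ := {f : C(K, X) | ∀ t, l ≤ (φ t).1 → f t = 0}) ?_ ?_
  · simp only [Set.ofPred_forall]
    exact isClosed_iInter fun s => isClosed_iInter fun t => isClosed_iInter fun _ =>
      isClosed_eq (hev s) (hev t)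
  · simp only [Set.ofPred_forall]
    exact isClosed_iInter fun t => isClosed_iInter fun _ => isClosed_eq (hev t) continuous_const
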